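/- arXiv:1901.01980 — 2 statements merged into one kernel-verified Lean document; each statement's English description precedes it below -/
import Mathlib

section
/- For each integer N ≥ 2 there exist a compact metric space (L,d) and a flow Y^t on L such that Y^t is (N+1)-expansive but Y^t is not N-expansive. -/
open Set Metric

/-- `α` belongs to `ℋ(A)`: a family of homeomorphisms of `ℝ` fixing the origin,
indexed by points of `A`, such that `α x_α = id` for some `x_α ∈ A` and
for each fixed `t` the map `x ↦ α x t` is continuous on `A`. -/
def MemH {M : Type*} [MetricSpace M] (A : Set M) (α : M → ℝ ≃ₜ ℝ) (xα : M) : Prop :=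
  xα ∈ A ∧ (∀ t : ℝ, α xα t = t) ∧ (∀ x ∈ A, α x 0 = 0) ∧
    ∀ t : ℝ, ContinuousOn (fun x => α x t) A

/-- A flow `φ` on a metric space is `N`-expansive if for every `ε > 0` there is `δ > 0`
such that whenever `A ⊆ M` and `α ∈ ℋ(A)` satisfy `diam(𝒳ᵗ_α(A)) < δ` for all `t ∈ ℝ`,
there is `B ⊆ A` with at most `N` elements such that `A ⊆ X^{(-ε,ε)}(B)`. -/
def NExpansive {M : Type*} [MetricSpace M] (φ : Flow ℝ M) (N : ℕ) : Prop :=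
  ∀ ε : ℝ, 0 < ε → ∃ δ : ℝ, 0 < δ ∧
    ∀ (A : Set M) (α : M → ℝ ≃ₜ ℝ) (xα : M), MemH A α xα →
      (∀ t : ℝ, Metric.diam ((fun x => φ (α x t) x) '' A) < δ) →
      ∃ B ⊆ A, B.Finite ∧ B.ncard ≤ N ∧
        ∀ a ∈ A, ∃ b ∈ B, ∃ s : ℝ, |s| < ε ∧ φ s b = a

namespace ExpFlow

open Filter Topology OnePoint

instance metrizableP : TopologicalSpace.MetrizableSpace (OnePoint ℝ) :=
  (onePointEquivSphereOfFinrankEq (ι := Fin 2) (V := ℝ) (by simp)).isEmbedding.metrizableSpace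

noncomputable instance metricP : MetricSpace (OnePoint ℝ) :=
  TopologicalSpace.metrizableSpaceMetric (OnePoint ℝ)

/-- translation on the one-point compactification of the line -/
def sh (t : ℝ) (p : OnePoint ℝ) : OnePoint ℝ := OnePoint.map (fun x => x + t) p

@[simp] lemma sh_coe (t x : ℝ) : sh t (x : OnePoint ℝ) = ((x + t : ℝ) : OnePoint ℝ) := rfl

@[simp] lemma sh_infty (t : ℝ) : sh t (∞ : OnePoint ℝ) = ∞ := rfl

lemma sh_sh (s t : ℝ) (p : OnePoint ℝ) : sh s (sh t p) = sh (t + s) p := by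
  induction p using OnePoint.rec with
  | infty => rfl
  | coe x => simp [add_assoc]

lemma sh_zero (p : OnePoint ℝ) : sh 0 p = p := by
  induction p using OnePoint.rec with
  | infty => rfl
  | coe x => simp

lemma tendsto_add_cocompact (t : ℝ) :
    Tendsto (fun q : ℝ × ℝ => q.2 + q.1) (𝓝 t ×ˢ cocompact ℝ) (cocompact ℝ) := by
  rw [← Metric.cobounded_eq_cocompact, ← comap_norm_atTop, tendsto_comap_iff,
    comap_norm_atTop, Metric.cobounded_eq_cocompact, Filter.tendsto_atTop]
  intro b
  have h1 : ∀ᶠ s in 𝓝 t, ‖s‖ < ‖t‖ + 1 :=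
    (continuous_norm.tendsto t).eventually_lt_const (by linarith)
  have h2 : ∀ᶠ x in cocompact ℝ, b + ‖t‖ + 1 ≤ ‖x‖ :=
    (tendsto_norm_cocompact_atTop (E := ℝ)).eventually_ge_atTop _
  filter_upwards [h1.prod_mk h2] with q hq
  simp only [Function.comp_apply]
  have := norm_sub_le (q.2 + q.1) q.1
  rw [add_sub_cancel_right] at this
  linarith [hq.1, hq.2]

lemma continuous_sh : Continuous (fun q : ℝ × OnePoint ℝ => sh q.1 q.2) := by
  rw [continuous_iff_continuousAt]
  rintro ⟨t, p⟩
  induction p using OnePoint.rec with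
  | infty =>
    rw [ContinuousAt, nhds_prod_eq, OnePoint.nhds_infty_eq, prod_sup]
    refine Tendsto.sup ?_ ?_
    · rw [coclosedCompact_eq_cocompact]
      have h5 := OnePoint.tendsto_coe_infty (X := ℝ)
      rw [coclosedCompact_eq_cocompact] at h5
      have := h5.comp (tendsto_add_cocompact t)
      have h3 : 𝓝 t ×ˢ map ((↑) : ℝ → OnePoint ℝ) (cocompact ℝ)
          = map (Prod.map id (↑)) (𝓝 t ×ˢ cocompact ℝ) := by
        rw [← prod_map_map_eq', Filter.map_id]
      rw [h3, tendsto_map'_iff]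
      exact this
    · rw [prod_pure, tendsto_map'_iff]
      simp only [Function.comp_def, sh_infty]
      exact tendsto_const_nhds
  | coe x =>
    have ho : IsOpenEmbedding (Prod.map id ((↑) : ℝ → OnePoint ℝ) : ℝ × ℝ → ℝ × OnePoint ℝ) :=
      IsOpenEmbedding.id.prodMap OnePoint.isOpenEmbedding_coe
    have := ho.continuousAt_iff (g := fun q : ℝ × OnePoint ℝ => sh q.1 q.2) (x := (t, x))
    refine this.1 ?_
    have h4 : Continuous (fun q : ℝ × ℝ => ((q.2 + q.1 : ℝ) : OnePoint ℝ)) :=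
      OnePoint.continuous_coe.comp (continuous_snd.add continuous_fst)
    exact h4.continuousAt

/-- a continuous function vanishing exactly at infinity -/
noncomputable def ff (p : OnePoint ℝ) : ℝ := OnePoint.elim p 0 (fun x : ℝ => 1 / max 1 |x|)

@[simp] lemma ff_coe (x : ℝ) : ff (x : OnePoint ℝ) = 1 / max 1 |x| := rfl

@[simp] lemma ff_infty : ff (∞ : OnePoint ℝ) = 0 := rfl

lemma continuous_ff : Continuous ff := by
  rw [OnePoint.continuous_iff]
  constructor
  · rw [coclosedCompact_eq_cocompact]
    simp only [ff_infty, ff_coe, one_div]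
    refine tendsto_inv_atTop_zero.comp ?_
    exact tendsto_atTop_mono (fun x => le_max_right _ _) (tendsto_norm_cocompact_atTop (E := ℝ))
  · simp only [ff_coe]
    refine continuous_const.div (by fun_prop) ?_
    intro x
    have : (1 : ℝ) ≤ max 1 |x| := le_max_left _ _
    positivity

abbrev T := AddCircle (1 : ℝ)

abbrev E := T × OnePoint ℝ × OnePoint ℝ

noncomputable def flowE : Flow ℝ E where
  toFun t p := (p.1 + (t : T), sh t p.2.1, sh t p.2.2)
  cont' := by
    have h1 : Continuous (fun q : ℝ × E => sh q.1 q.2.2.1) :=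
      continuous_sh.comp (f := fun q : ℝ × E => (q.1, q.2.2.1)) (by fun_prop)
    have h2 : Continuous (fun q : ℝ × E => sh q.1 q.2.2.2) :=
      continuous_sh.comp (f := fun q : ℝ × E => (q.1, q.2.2.2)) (by fun_prop)
    have h3 : Continuous (fun q : ℝ × E => q.2.1 + (q.1 : T)) :=
      (by fun_prop : Continuous (fun q : ℝ × E => q.2.1)).add
        ((AddCircle.continuous_mk' (1 : ℝ)).comp continuous_fst)
    exact h3.prodMk (h1.prodMk h2)
  map_add' s t p := by
    simp only [sh_sh, AddCircle.coe_add, add_comm s t, add_assoc]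
  map_zero' p := by simp [sh_zero]

lemma flowE_apply (t : ℝ) (p : E) :
    flowE t p = (p.1 + (t : T), sh t p.2.1, sh t p.2.2) := rfl

noncomputable def off (N : ℕ) (j : Fin (N + 1)) (x : ℝ) (v : OnePoint ℝ) : ℝ :=
  (j : ℝ) / (N + 1) * ff (sh (-x) v)

/-- the phase `θ` agrees with `u` up to one of `N + 1` offsets -/
def S (N : ℕ) : Set (T × OnePoint ℝ × OnePoint ℝ) :=
  {q | ∀ x : ℝ, q.2.1 = x → ∃ j : Fin (N + 1), q.1 = ((x + off N j x q.2.2 : ℝ) : T)}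

def S3 : Set (OnePoint ℝ × OnePoint ℝ) :=
  {q | ∀ x y : ℝ, q.1 = x → q.2 = y → ∃ k : ℤ, y - x = k}

def LS (N : ℕ) : Set E :=
  {q | q ∈ S N ∧ (q.1, q.2.2, q.2.1) ∈ S N ∧ q.2 ∈ S3}

lemma continuous_off (N : ℕ) (j : Fin (N + 1)) :
    Continuous (fun q : ℝ × OnePoint ℝ => off N j q.1 q.2) := by
  unfold off
  exact continuous_const.mul (continuous_ff.comp
    (continuous_sh.comp (f := fun q : ℝ × OnePoint ℝ => (-q.1, q.2)) (by fun_prop)))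

lemma isClosed_S (N : ℕ) : IsClosed (S N) := by
  have ho : IsOpenEmbedding (Prod.map id (Prod.map ((↑) : ℝ → OnePoint ℝ) id) :
      T × ℝ × OnePoint ℝ → T × OnePoint ℝ × OnePoint ℝ) :=
    IsOpenEmbedding.id.prodMap (OnePoint.isOpenEmbedding_coe.prodMap IsOpenEmbedding.id)
  have hc : IsClosed (⋃ j : Fin (N + 1), {q : T × ℝ × OnePoint ℝ |
      q.1 = ((q.2.1 + off N j q.2.1 q.2.2 : ℝ) : T)}) := by
    refine isClosed_iUnion_of_finite fun j => isClosed_eq continuous_fst ?_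
    refine (AddCircle.continuous_mk' (1 : ℝ)).comp ?_
    exact (by fun_prop : Continuous (fun q : T × ℝ × OnePoint ℝ => q.2.1)).add
      ((continuous_off N j).comp continuous_snd)
  have := ho.isOpenMap _ hc.isOpen_compl
  rw [← isOpen_compl_iff]
  convert this using 1
  ext ⟨θ, u, v⟩
  simp only [S, mem_compl_iff, mem_ofPred_eq, not_forall, mem_image, mem_iUnion, Prod.exists,
    Prod.map_apply, id, Prod.mk.injEq]
  constructor
  · rintro ⟨x, h, h'⟩
    exact ⟨θ, x, v, h', rfl, h.symm, rfl⟩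
  · rintro ⟨_, x, _, h', rfl, h, rfl⟩
    exact ⟨x, h.symm, h'⟩

lemma isClosed_S3 : IsClosed S3 := by
  have ho : IsOpenEmbedding (Prod.map ((↑) : ℝ → OnePoint ℝ) ((↑) : ℝ → OnePoint ℝ)) :=
    OnePoint.isOpenEmbedding_coe.prodMap OnePoint.isOpenEmbedding_coe
  have hc : IsClosed {q : ℝ × ℝ | q.2 - q.1 ∈ Set.range ((↑) : ℤ → ℝ)} :=
    (Int.isClosedEmbedding_coe_real.isClosed_range).preimage
      (f := fun q : ℝ × ℝ => q.2 - q.1) (by fun_prop)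
  have := ho.isOpenMap _ hc.isOpen_compl
  rw [← isOpen_compl_iff]
  convert this using 1
  ext ⟨u, v⟩
  simp only [S3, mem_compl_iff, mem_ofPred_eq, not_forall, mem_image, Prod.exists,
    Prod.map_apply, Prod.mk.injEq, mem_range]
  constructor
  · rintro ⟨x, y, h, h', h''⟩
    exact ⟨x, y, fun ⟨k, hk⟩ => h'' ⟨k, hk.symm⟩, h.symm, h'.symm⟩
  · rintro ⟨x, y, h'', h, h'⟩
    exact ⟨x, y, h.symm, h'.symm, fun ⟨k, hk⟩ => h'' ⟨k, hk.symm⟩⟩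

lemma isClosed_LS (N : ℕ) : IsClosed (LS N) := by
  refine (isClosed_S N).inter (((isClosed_S N).preimage
    (f := fun q : E => (q.1, q.2.2, q.2.1)) (by fun_prop)).inter
    (isClosed_S3.preimage (f := fun q : E => q.2) (by fun_prop)))

lemma sh_eq_coe {t x : ℝ} {p : OnePoint ℝ} (h : sh t p = x) : p = ((x - t : ℝ) : OnePoint ℝ) := by
  have := congrArg (sh (-t)) h
  rw [sh_sh, add_neg_cancel, sh_zero, sh_coe] at this
  rw [this, sub_eq_add_neg]

lemma S_inv {N : ℕ} {q : T × OnePoint ℝ × OnePoint ℝ} (h : q ∈ S N) (t : ℝ) :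
    (q.1 + (t : T), sh t q.2.1, sh t q.2.2) ∈ S N := by
  intro x hx
  obtain ⟨j, hj⟩ := h _ (sh_eq_coe hx)
  refine ⟨j, ?_⟩
  simp only [off, sh_sh] at hj ⊢
  rw [hj, ← AddCircle.coe_add]
  congr 1
  rw [show -(x - t) = t + -x by ring]
  ring

lemma LS_inv (N : ℕ) : IsInvariant flowE (LS N) := by
  intro t q hq
  refine ⟨S_inv hq.1 t, S_inv hq.2.1 t, ?_⟩
  intro x y hx hy
  obtain ⟨k, hk⟩ := hq.2.2 _ _ (sh_eq_coe hx) (sh_eq_coe hy)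
  exact ⟨k, by linarith⟩

noncomputable def flowL (N : ℕ) : Flow ℝ (LS N) := flowE.restrict (LS_inv N)

lemma coe_flowL (N : ℕ) (t : ℝ) (p : LS N) : (flowL N t p : E) = flowE t p := rfl

instance (N : ℕ) : CompactSpace (LS N) :=
  isCompact_iff_compactSpace.1 (isClosed_LS N).isCompact

/-- closeness to the origin of the line -/
lemma near_zero (η : ℝ) (hη : 0 < η) : ∃ δ : ℝ, 0 < δ ∧ ∀ p : OnePoint ℝ,
    dist p ((0 : ℝ) : OnePoint ℝ) < δ → ∃ y : ℝ, p = y ∧ |y| < η := by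
  have ho : IsOpen (((↑) : ℝ → OnePoint ℝ) '' Metric.ball 0 η) :=
    OnePoint.isOpenEmbedding_coe.isOpenMap _ Metric.isOpen_ball
  obtain ⟨δ, hδ, h⟩ := Metric.isOpen_iff.1 ho _ (mem_image_of_mem _ (Metric.mem_ball_self hη))
  refine ⟨δ, hδ, fun p hp => ?_⟩
  obtain ⟨y, hy, rfl⟩ := h (Metric.mem_ball.2 hp)
  exact ⟨y, rfl, by simpa using hy⟩

/-- A continuous real function starting at zero that stays near the integers stays near zero. -/
lemma drift (D : ℝ → ℝ) (hD : Continuous D) (h0 : D 0 = 0) (r : ℝ) (hr : r ≤ 1 / 4)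
    (h : ∀ t, ‖((D t : ℝ) : T)‖ < r) (t : ℝ) : |D t| < r := by
  have key : ∀ t, |D t| ≤ 1 / 4 := by
    intro t
    by_contra! hc
    have hcont : Continuous fun t => |D t| := hD.abs
    have : (1 / 4 : ℝ) ∈ Set.uIcc (|D 0|) (|D t|) := by
      rw [Set.mem_uIcc]; left; rw [h0]; constructor
      · simp
      · exact hc.le
    obtain ⟨s, -, hs⟩ := intermediate_value_uIcc (a := 0) (b := t) hcont.continuousOn this
    have hs' : |D s| = 1 / 4 := hs
    have := h s
    rw [(AddCircle.norm_coe_eq_abs_iff (1 : ℝ) one_ne_zero).2 (by rw [hs', abs_one]; norm_num)]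
      at this
    linarith
  have := h t
  rwa [(AddCircle.norm_coe_eq_abs_iff (1 : ℝ) one_ne_zero).2
    (by rw [abs_one]; linarith [key t])] at this

lemma lift_T (z : T) : ∃ s : ℝ, (s : T) = z ∧ |s| = ‖z‖ := by
  induction z using QuotientAddGroup.induction_on with
  | H x =>
    refine ⟨x - round x, ?_, ?_⟩
    · have hr : (((round x : ℤ) : ℝ) : T) = 0 := by
        rw [AddCircle.coe_eq_zero_iff]; exact ⟨round x, by simp⟩
      rw [AddCircle.coe_sub, hr, sub_zero]
    · exact (UnitAddCircle.norm_eq (x := x)).symm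

/-- Finite coordinates are followed closely. -/
lemma follow {η δ : ℝ} (hδη : δ ≤ η) (hδ : ∀ p : OnePoint ℝ,
    dist p ((0 : ℝ) : OnePoint ℝ) < δ → ∃ y : ℝ, p = y ∧ |y| < η)
    (α : ℝ ≃ₜ ℝ) (hα : ∀ t, |α t - t| < 2 * δ) (p p' : OnePoint ℝ)
    (h : ∀ t, dist (sh (α t) p') (sh t p) < δ) :
    (p = ∞ ∧ p' = ∞) ∨ ∃ x s : ℝ, p = x ∧ p' = ((x + s : ℝ) : OnePoint ℝ) ∧ |s| < 3 * η := by
  induction p using OnePoint.rec with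
  | infty =>
    left
    refine ⟨rfl, ?_⟩
    induction p' using OnePoint.rec with
    | infty => rfl
    | coe x =>
      exfalso
      have := h (α.symm (-x))
      rw [α.apply_symm_apply, sh_coe, add_neg_cancel, sh_infty, dist_comm] at this
      obtain ⟨y, hy, -⟩ := hδ _ this
      exact OnePoint.infty_ne_coe y hy
  | coe x =>
    right
    have := h (-x)
    rw [sh_coe, add_neg_cancel] at this
    obtain ⟨y, hy, hy'⟩ := hδ _ this
    refine ⟨x, y - α (-x) - x, rfl, ?_, ?_⟩
    · rw [sh_eq_coe hy]; congr 1; ring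
    · have := hα (-x)
      rw [abs_lt] at *
      constructor <;> linarith [hy'.1, hy'.2, this.1, this.2]

/-- representatives of the orbits following `a` -/
noncomputable def clone (N : ℕ) (a : E) (j : Fin (N + 1)) : E :=
  OnePoint.elim a.2.1 a (fun x : ℝ => (((x + off N j x a.2.2 : ℝ) : T), a.2.1, a.2.2))

lemma rep {N : ℕ} {η δ : ℝ} (hη : η ≤ 1 / 8) (hδη : δ ≤ η) (hδ : ∀ p : OnePoint ℝ,
    dist p ((0 : ℝ) : OnePoint ℝ) < δ → ∃ y : ℝ, p = y ∧ |y| < η)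
    (α : ℝ ≃ₜ ℝ) (hα0 : α 0 = 0) (a x : E) (ha : a ∈ LS N) (hx : x ∈ LS N)
    (h : ∀ t, dist (flowE (α t) x) (flowE t a) < δ) :
    ∃ (j : Fin (N + 1)) (s : ℝ), |s| < 3 * η ∧ flowE s (clone N a j) = x := by
  obtain ⟨θ, u, v⟩ := a
  obtain ⟨θ', u', v'⟩ := x
  simp only [flowE_apply, Prod.dist_eq, max_lt_iff] at h
  have hpos : 0 < δ := dist_nonneg.trans_lt (h 0).1
  have hθ0 : ‖θ' - θ‖ < δ := by
    have := (h 0).1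
    rwa [hα0, AddCircle.coe_zero, add_zero, add_zero, dist_eq_norm] at this
  have hα : ∀ t, |α t - t| < 2 * δ := by
    refine drift (fun t => α t - t) (α.continuous.sub continuous_id) (by simp [hα0]) _
      (by linarith) ?_
    intro t
    have h1 := (h t).1
    rw [dist_eq_norm] at h1
    have : ((α t - t : ℝ) : T) = (θ' + (α t : T) - (θ + (t : T))) - (θ' - θ) := by
      rw [AddCircle.coe_sub]; abel
    rw [this]
    exact (norm_sub_le _ _).trans_lt (by linarith)
  have hu := follow hδη hδ α hα u u' (fun t => (h t).2.1)
  have hv := follow hδη hδ α hα v v' (fun t => (h t).2.2)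
  obtain ⟨s0, hs0, hs0'⟩ := lift_T (θ' - θ)
  obtain ⟨ha1, ha2, ha3⟩ := ha
  obtain ⟨hx1, hx2, hx3⟩ := hx
  rcases hu with ⟨rfl, rfl⟩ | ⟨p, s, rfl, rfl, hs⟩
  · rcases hv with ⟨rfl, rfl⟩ | ⟨q, r, rfl, rfl, hr⟩
    · refine ⟨0, s0, by linarith, ?_⟩
      simp [clone, flowE_apply, hs0]
    · refine ⟨0, r, hr, ?_⟩
      obtain ⟨j, hj⟩ := ha2 q rfl
      obtain ⟨j', hj'⟩ := hx2 (q + r) rfl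
      simp only [off, sh_infty, ff_infty, mul_zero, add_zero] at hj hj'
      simp [clone, flowE_apply, hj, hj']
  · obtain ⟨j', hj'⟩ := hx1 (p + s) rfl
    refine ⟨j', s, hs, ?_⟩
    rcases hv with ⟨rfl, rfl⟩ | ⟨q, r, rfl, rfl, hr⟩
    · simp only [off, sh_infty, ff_infty, mul_zero, add_zero] at hj'
      simp [clone, flowE_apply, hj', off]
    · obtain ⟨k, hk⟩ := ha3 p q rfl rfl
      obtain ⟨k', hk'⟩ := hx3 (p + s) (q + r) rfl rfl
      have hkk : k' = k := by
        have h1 : ((k' - k : ℤ) : ℝ) = r - s := by push_cast; linarith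
        rw [abs_lt] at hs hr
        have h2 : ((k' - k : ℤ) : ℝ) < 1 := by rw [h1]; linarith
        have h3 : (-1 : ℝ) < ((k' - k : ℤ) : ℝ) := by rw [h1]; linarith
        have h4 : k' - k < 1 := by exact_mod_cast h2
        have h5 : -1 < k' - k := by exact_mod_cast h3
        omega
      have hrs : r = s := by rw [hkk] at hk'; linarith
      subst hrs
      simp only at hj'
      simp only [clone, flowE_apply, OnePoint.elim_some, sh_coe, Prod.mk.injEq, and_true]
      rw [hj', ← AddCircle.coe_add]
      congr 1
      simp only [off, sh_coe]
      rw [show q + r + -(p + r) = q + -p by ring]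
      ring

lemma expansive (N : ℕ) : NExpansive (flowL N) (N + 1) := by
  intro ε hε
  set η := min (ε / 6) (1 / 8) with hηdef
  have hη : 0 < η := by positivity
  obtain ⟨δ₀, hδ₀, hnear⟩ := near_zero η hη
  refine ⟨min δ₀ η, lt_min hδ₀ hη, ?_⟩
  intro A α a ⟨haA, haid, h0, _⟩ hdiam
  have hrep : ∀ x ∈ A, ∃ (j : Fin (N + 1)) (s : ℝ), |s| < 3 * η ∧
      flowE s (clone N a j) = (x : E) := by
    intro x hx
    refine rep (min_le_right _ _) (min_le_right δ₀ η)
      (fun p hp => hnear p (hp.trans_le (min_le_left _ _))) (α x) (h0 x hx) a x a.2 x.2 ?_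
    intro t
    have h1 := Metric.dist_le_diam_of_mem (s := (fun x => flowL N (α x t) x) '' A)
      (Metric.isBounded_of_compactSpace) (mem_image_of_mem _ hx) (mem_image_of_mem _ haA)
    have h2 := h1.trans_lt (hdiam t)
    simp only [haid] at h2
    exact h2
  have hb : ∀ j : Fin (N + 1), ∃ b ∈ A, (∃ x ∈ A, ∃ s : ℝ, |s| < 3 * η ∧
      flowE s (clone N a j) = (x : E)) → ∃ s : ℝ, |s| < 3 * η ∧
      flowE s (clone N a j) = (b : E) := by
    intro j
    by_cases hj : ∃ x ∈ A, ∃ s : ℝ, |s| < 3 * η ∧ flowE s (clone N a j) = (x : E)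
    · obtain ⟨x, hx, hs⟩ := hj
      exact ⟨x, hx, fun _ => hs⟩
    · exact ⟨a, haA, fun h => absurd h hj⟩
  choose b hbA hb using hb
  refine ⟨Set.range b, ?_, Set.finite_range b, ?_, ?_⟩
  · rintro _ ⟨j, rfl⟩; exact hbA j
  · rw [← Set.image_univ]
    refine (Set.ncard_image_le Set.finite_univ).trans ?_
    rw [Set.ncard_univ, Nat.card_eq_fintype_card, Fintype.card_fin]
  · intro x hx
    obtain ⟨j, s, hs, hsx⟩ := hrep x hx
    obtain ⟨s', hs', hsb⟩ := hb j ⟨x, hx, s, hs, hsx⟩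
    refine ⟨b j, ⟨j, rfl⟩, s - s', ?_, ?_⟩
    · have : η ≤ ε / 6 := min_le_left _ _
      rw [abs_lt] at *
      constructor <;> linarith [hs.1, hs.2, hs'.1, hs'.2]
    · apply Subtype.ext
      rw [coe_flowL, ← hsb, ← Flow.map_add, sub_add_cancel, hsx]

noncomputable def pt (N k : ℕ) (j : Fin (N + 1)) : E :=
  ((((j : ℝ) / (N + 1) * (1 / max 1 (k : ℝ)) : ℝ) : T), ((0 : ℝ) : OnePoint ℝ), ((k : ℝ) : OnePoint ℝ))

lemma pt_mem (N k : ℕ) (j : Fin (N + 1)) : pt N k j ∈ LS N := by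
  refine ⟨?_, ?_, ?_⟩
  · intro x hx
    have hx : (0 : ℝ) = x := OnePoint.coe_injective hx
    subst hx
    refine ⟨j, ?_⟩
    simp [pt, off]
  · intro x hx
    have hx : (k : ℝ) = x := OnePoint.coe_injective hx
    subst hx
    refine ⟨j, ?_⟩
    have hk : (((k : ℕ) : ℝ) : T) = 0 := by
      rw [AddCircle.coe_eq_zero_iff]; exact ⟨k, by simp⟩
    rw [AddCircle.coe_add, hk, zero_add]
    simp [pt, off]
  · intro x y hx hy
    have hx : (0 : ℝ) = x := OnePoint.coe_injective hx
    have hy : (k : ℝ) = y := OnePoint.coe_injective hy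
    subst hx hy
    exact ⟨k, by simp⟩

lemma not_expansive (N : ℕ) : ¬ NExpansive (flowL N) N := by
  intro h
  obtain ⟨δ, hδ, h⟩ := h 1 one_pos
  obtain ⟨k, hk⟩ := exists_nat_gt (max 1 (1 / δ))
  have hk1 : (1 : ℝ) < k := (le_max_left _ _).trans_lt hk
  have hkδ : 1 / (k : ℝ) < δ := by
    have := (le_max_right _ _).trans_lt hk
    rw [div_lt_iff₀ (by linarith)]
    rw [div_lt_iff₀ hδ] at this
    linarith
  have hmax : max 1 (k : ℝ) = k := max_eq_right hk1.le
  let c : Fin (N + 1) → LS N := fun j => ⟨pt N k j, pt_mem N k j⟩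
  have hval : ∀ j : Fin (N + 1), 0 ≤ (j : ℝ) / (N + 1) * (1 / (k : ℝ)) ∧
      (j : ℝ) / (N + 1) * (1 / (k : ℝ)) < 1 / k := by
    intro j
    refine ⟨by positivity, ?_⟩
    have h1 : (j : ℝ) / (N + 1) < 1 := by
      rw [div_lt_one (by positivity)]
      exact_mod_cast j.2
    have h2 : 0 < 1 / (k : ℝ) := by positivity
    nlinarith
  have hk1' : 1 / (k : ℝ) ≤ 1 := by
    rw [div_le_one (by linarith)]; exact hk1.le
  have hinj : Function.Injective c := by
    intro i j hij
    have h1 : (pt N k i).1 = (pt N k j).1 := congrArg (fun z : LS N => (z : E).1) hij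
    simp only [pt, hmax] at h1
    have : Fact ((0 : ℝ) < 1) := ⟨one_pos⟩
    rw [AddCircle.coe_eq_coe_iff_of_mem_Ico (a := (0 : ℝ))
      ⟨(hval i).1, by linarith [(hval i).2]⟩ ⟨(hval j).1, by linarith [(hval j).2]⟩] at h1
    have hk0 : 1 / (k : ℝ) ≠ 0 := by positivity
    have hN0 : (N + 1 : ℝ) ≠ 0 := by positivity
    have h2 := mul_right_cancel₀ hk0 h1
    rw [div_left_inj' hN0] at h2
    exact Fin.ext (by exact_mod_cast h2)
  obtain ⟨B, hBA, hBf, hBN, hB⟩ := h (Set.range c) (fun _ => Homeomorph.refl ℝ) (c 0)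
    ⟨⟨0, rfl⟩, fun _ => rfl, fun _ _ => rfl, fun _ => continuousOn_const⟩ (by
      intro t
      refine lt_of_le_of_lt (Metric.diam_le_of_forall_dist_le (by positivity) ?_) hkδ
      rintro _ ⟨_, ⟨i, rfl⟩, rfl⟩ _ ⟨_, ⟨j, rfl⟩, rfl⟩
      change dist (flowE t (pt N k i)) (flowE t (pt N k j)) ≤ 1 / k
      simp only [flowE_apply, pt, Prod.dist_eq, dist_self, dist_add_right, hmax]
      refine max_le ?_ (by simp)
      rw [dist_eq_norm, ← AddCircle.coe_sub, UnitAddCircle.norm_eq]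
      refine (round_le _ 0).trans ?_
      rw [Int.cast_zero, sub_zero, abs_le]
      constructor <;> linarith [(hval i).1, (hval i).2, (hval j).1, (hval j).2])
  have hsub : Set.range c ⊆ B := by
    rintro _ ⟨j, rfl⟩
    obtain ⟨b, hb, s, -, hs⟩ := hB _ ⟨j, rfl⟩
    obtain ⟨i, rfl⟩ := hBA hb
    have h1 : sh s ((0 : ℝ) : OnePoint ℝ) = ((0 : ℝ) : OnePoint ℝ) :=
      congrArg (fun z : LS N => (z : E).2.1) hs
    rw [sh_coe] at h1
    have h2 := OnePoint.coe_injective h1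
    rw [zero_add] at h2
    subst h2
    rw [Flow.map_zero_apply] at hs
    rwa [← hs]
  have h3 := Set.ncard_le_ncard hsub hBf
  rw [← Set.image_univ, Set.ncard_image_of_injective _ hinj, Set.ncard_univ,
    Nat.card_eq_fintype_card, Fintype.card_fin] at h3
  omega

end ExpFlow

/-- For each integer `N ≥ 2` there exist a compact metric space and a flow on it which is
(N+1)-expansive but not N-expansive. -/
theorem exists_succExpansive_not_nExpansive (N : ℕ) (hN : 2 ≤ N) :
    ∃ (L : Type) (_ : MetricSpace L) (ψ : Flow ℝ L),
      CompactSpace L ∧ NExpansive ψ (N + 1) ∧ ¬ NExpansive ψ N := by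
  exact ⟨ExpFlow.LS N, inferInstance, ExpFlow.flowL N, inferInstance,
    ExpFlow.expansive N, ExpFlow.not_expansive N⟩
end

section
/- Let (M,d) be a compact metric space, let X^t be a flow on M without fixed points, let N > 0 be an integer, and let (𝒮,𝒯) be a δ-adequate pair of families of cross-sections of time ε, with associated constants θ, ρ, ε₀, projections P_ρ^i, first return map φ, and stable and unstable sets W^s_η, W^u_η as defined below. If X^t is N-expansive, then there exists η > 0 such that for every x ∈ ∪_{i=1}^k T_i the set W^s_η(x) ∩ W^u_η(x) has at most N points. -/
open Set Metric

/-- The image `X^J(E) = {X^t(x) : t ∈ J, x ∈ E}` of a set under a set of times. -/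
def flowIm {M : Type*} [MetricSpace M] (φ : Flow ℝ M) (J : Set ℝ) (E : Set M) : Set M :=
  Set.image2 (fun t x => φ t x) J E

/-- `S` is a cross-section of time `ε`: it is closed and each local orbit segment
`X^{(-ε,ε)}(x)` of a point `x ∈ S` meets `S` only at `x`. -/
def IsCrossSection {M : Type*} [MetricSpace M] (φ : Flow ℝ M) (ε : ℝ) (S : Set M) : Prop :=
  IsClosed S ∧ ∀ x ∈ S, ∀ t : ℝ, |t| < ε → φ t x ∈ S → φ t x = x

/-- The interior `S* = int(X^{(-ε,ε)}(S)) ∩ S` of a cross-section. -/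
def sectionStar {M : Type*} [MetricSpace M] (φ : Flow ℝ M) (ε : ℝ) (S : Set M) : Set M :=
  interior (flowIm φ (Set.Ioo (-ε) ε) S) ∩ S

/-- A δ-adequate pair `(𝒮,𝒯)` of finite families of cross-sections of time `ε` and diameter
at most `δ`, with `T i ⊆ (S i)*` and whose forward/backward `ε`-saturations cover `M`. -/
structure AdequatePair {M : Type*} [MetricSpace M] (φ : Flow ℝ M) (ε δ : ℝ)
    {k : ℕ} (S T : Fin k → Set M) : Prop where
  eps_pos : 0 < ε
  delta_pos : 0 < δ
  crossS : ∀ i, IsCrossSection φ ε (S i)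
  crossT : ∀ i, IsCrossSection φ ε (T i)
  diamS : ∀ i, Metric.diam (S i) ≤ δ
  diamT : ∀ i, Metric.diam (T i) ≤ δ
  T_sub : ∀ i, T i ⊆ sectionStar φ ε (S i)
  coverT_fwd : (Set.univ : Set M) = ⋃ i, flowIm φ (Set.Icc 0 ε) (T i)
  coverT_bwd : (Set.univ : Set M) = ⋃ i, flowIm φ (Set.Icc (-ε) 0) (T i)
  coverS_fwd : (Set.univ : Set M) = ⋃ i, flowIm φ (Set.Icc 0 ε) (S i)
  coverS_bwd : (Set.univ : Set M) = ⋃ i, flowIm φ (Set.Icc (-ε) 0) (S i)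

/-- `t` is the first-return time of `x` to `∪ᵢ Tᵢ`. -/
def IsFirstReturn {M : Type*} [MetricSpace M] (φ : Flow ℝ M) {k : ℕ}
    (T : Fin k → Set M) (x : M) (t : ℝ) : Prop :=
  0 < t ∧ φ t x ∈ ⋃ i, T i ∧ ∀ s : ℝ, 0 < s → s < t → φ s x ∉ ⋃ i, T i

/-- One step of the construction of the companion sequence: `x' = φ(x) = X^t(x)` is the
first return of `x` to `∪ᵢ Tᵢ`, landing in `T l`, and `y' = P_ρ^l(X^t(y))` is the
projection of `X^t(y)` to the section `S l` along a time of size `< ρ`. -/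
def ReturnStep {M : Type*} [MetricSpace M] (φ : Flow ℝ M) {k : ℕ}
    (S T : Fin k → Set M) (ρ : ℝ) (x y x' y' : M) : Prop :=
  ∃ t : ℝ, IsFirstReturn φ T x t ∧ x' = φ t x ∧
    ∃ l, x' ∈ T l ∧ y' ∈ S l ∧ ∃ s : ℝ, |s| < ρ ∧ y' = φ s (φ t y)

/-- The η-stable set `W^s_η(x)` of `x ∈ T i`: points `y ∈ S i` whose forward companion
sequence `y_j` along the first-return orbit `φ^j(x)` stays `η`-close for all `j ≥ 0`. -/
def stableSet {M : Type*} [MetricSpace M] (φ : Flow ℝ M) {k : ℕ}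
    (S T : Fin k → Set M) (ρ η : ℝ) (x : M) : Set M :=
  {y | ∃ i, x ∈ T i ∧ y ∈ S i ∧ ∃ X Y : ℕ → M, X 0 = x ∧ Y 0 = y ∧
    (∀ j : ℕ, ReturnStep φ S T ρ (X j) (Y j) (X (j + 1)) (Y (j + 1))) ∧
    ∀ j : ℕ, dist (X j) (Y j) < η}

/-- The η-unstable set `W^u_η(x)` of `x ∈ T i`: points `y ∈ S i` whose backward companion
sequence `y_j` along the first-return orbit `φ^j(x)` stays `η`-close for all `j ≤ 0`.
Here `X (j+1)` and `Y (j+1)` denote the points with index `-(j+1)`. -/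
def unstableSet {M : Type*} [MetricSpace M] (φ : Flow ℝ M) {k : ℕ}
    (S T : Fin k → Set M) (ρ η : ℝ) (x : M) : Set M :=
  {y | ∃ i, x ∈ T i ∧ y ∈ S i ∧ ∃ X Y : ℕ → M, X 0 = x ∧ Y 0 = y ∧
    (∀ j : ℕ, ReturnStep φ S T ρ (X (j + 1)) (Y (j + 1)) (X j) (Y j)) ∧
    ∀ j : ℕ, dist (X j) (Y j) < η}


theorem aux_pl_strictMono (u : ℤ → ℝ) (c : ℝ) (hc : 0 < c) (hu : ∀ j, c ≤ u (j + 1) - u j) :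
    StrictMono (fun r : ℝ => u ⌊r⌋ + Int.fract r * (u (⌊r⌋ + 1) - u ⌊r⌋)) := by
  have hmono : StrictMono u := strictMono_int_of_lt_succ (fun j => by linarith [hu j])
  intro a b hab
  show u ⌊a⌋ + Int.fract a * (u (⌊a⌋ + 1) - u ⌊a⌋) < u ⌊b⌋ + Int.fract b * (u (⌊b⌋ + 1) - u ⌊b⌋)
  have ha1 := Int.fract_lt_one a
  have hb0 := Int.fract_nonneg b
  rcases (Int.floor_mono hab.le).eq_or_lt with h | h
  · have : Int.fract a < Int.fract b := by
      unfold Int.fract; rw [h]; linarith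
    rw [h]
    have := hu ⌊b⌋
    nlinarith
  · have h1 : u (⌊a⌋ + 1) ≤ u ⌊b⌋ := hmono.monotone (by omega)
    have h2 := hu ⌊a⌋
    have h3 := hu ⌊b⌋
    nlinarith [mul_nonneg hb0 (by linarith : 0 ≤ u (⌊b⌋ + 1) - u ⌊b⌋)]

theorem aux_pl_int (u : ℤ → ℝ) (j : ℤ) (r : ℝ) (h0 : 0 ≤ r) (h1 : r < 1) :
    (fun r : ℝ => u ⌊r⌋ + Int.fract r * (u (⌊r⌋ + 1) - u ⌊r⌋)) (j + r)
      = u j + r * (u (j + 1) - u j) := by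
  have hf : ⌊(j : ℝ) + r⌋ = j := by
    rw [Int.floor_eq_iff]; constructor <;> linarith
  have hr : Int.fract ((j : ℝ) + r) = r := by
    unfold Int.fract; rw [hf]; ring
  simp only [hf, hr]

theorem aux_pl_surj (u : ℤ → ℝ) (c : ℝ) (hc : 0 < c) (hu : ∀ j, c ≤ u (j + 1) - u j) :
    Function.Surjective (fun r : ℝ => u ⌊r⌋ + Int.fract r * (u (⌊r⌋ + 1) - u ⌊r⌋)) := by
  have hmono : StrictMono u := strictMono_int_of_lt_succ (fun j => by linarith [hu j])
  have hup : ∀ n : ℕ, u 0 + c * n ≤ u n := by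
    intro n
    induction n with
    | zero => simp
    | succ n ih => have := hu n; push_cast; linarith
  have hdn : ∀ n : ℕ, u (-(n : ℤ)) ≤ u 0 - c * n := by
    intro n
    induction n with
    | zero => simp
    | succ n ih =>
      have := hu (-((n + 1 : ℕ) : ℤ))
      have e : -((n + 1 : ℕ) : ℤ) + 1 = -(n : ℤ) := by push_cast; ring
      rw [e] at this
      push_cast at *; linarith
  intro t
  obtain ⟨n, hn⟩ := exists_nat_gt ((t - u 0) / c)
  obtain ⟨m, hm⟩ := exists_nat_gt ((u 0 - t) / c)
  rw [div_lt_iff₀ hc] at hn hm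
  obtain ⟨j, hj, hj'⟩ := Int.exists_greatest_of_bdd (P := fun j => u j ≤ t)
    ⟨n, fun z hz => by
      by_contra hlt
      have := hmono (not_le.mp hlt)
      have := hup n
      linarith⟩
    ⟨-(m : ℤ), by have := hdn m; linarith⟩
  have hlt : t < u (j + 1) := by
    by_contra hge
    have := hj' (j + 1) (not_lt.mp hge)
    omega
  have hg : 0 < u (j + 1) - u j := by linarith [hu j]
  refine ⟨j + (t - u j) / (u (j + 1) - u j), ?_⟩
  rw [aux_pl_int u j _ (div_nonneg (by linarith) hg.le) (by rw [div_lt_one hg]; linarith)]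
  field_simp
  ring

theorem aux_pl_homeo (τ σ : ℤ → ℝ) (c : ℝ) (hc : 0 < c) (hτ : ∀ j, c ≤ τ (j + 1) - τ j)
    (hσ : ∀ j, c ≤ σ (j + 1) - σ j) (hτ0 : τ 0 = 0) (hσ0 : σ 0 = 0) :
    ∃ h : ℝ ≃ₜ ℝ, h 0 = 0 ∧ ∀ t, ∃ (j : ℤ) (r : ℝ), 0 ≤ r ∧ r < 1 ∧
      t = r * (τ (j + 1) - τ j) + τ j ∧ h t = r * (σ (j + 1) - σ j) + σ j := by
  let P := (aux_pl_strictMono τ c hc hτ).orderIsoOfSurjective _ (aux_pl_surj τ c hc hτ)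
  let Q := (aux_pl_strictMono σ c hc hσ).orderIsoOfSurjective _ (aux_pl_surj σ c hc hσ)
  have key : ∀ r, (P.symm.trans Q).toHomeomorph (P r) = Q r := by
    intro r
    show Q (P.symm (P r)) = Q r
    rw [OrderIso.symm_apply_apply]
  have hP : ∀ r : ℝ, P r = τ ⌊r⌋ + Int.fract r * (τ (⌊r⌋ + 1) - τ ⌊r⌋) := fun r => rfl
  have hQ : ∀ r : ℝ, Q r = σ ⌊r⌋ + Int.fract r * (σ (⌊r⌋ + 1) - σ ⌊r⌋) := fun r => rfl
  refine ⟨(P.symm.trans Q).toHomeomorph, ?_, ?_⟩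
  · have h1 : P 0 = 0 := by rw [hP]; simp [hτ0]
    have h2 : Q 0 = 0 := by rw [hQ]; simp [hσ0]
    have := key 0
    rwa [h1, h2] at this
  · intro t
    refine ⟨⌊P.symm t⌋, Int.fract (P.symm t), Int.fract_nonneg _, Int.fract_lt_one _, ?_, ?_⟩
    · have := hP (P.symm t)
      rw [OrderIso.apply_symm_apply] at this
      linarith
    · have := key (P.symm t)
      rw [OrderIso.apply_symm_apply, hQ] at this
      linarith

theorem aux_sums (g : ℤ → ℝ) : ∃ τ : ℤ → ℝ, τ 0 = 0 ∧ ∀ j, τ (j + 1) - τ j = g j := by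
  let τ : ℤ → ℝ := fun j => match j with
    | Int.ofNat n => ∑ i ∈ Finset.range n, g i
    | Int.negSucc n => -∑ i ∈ Finset.range (n + 1), g (Int.negSucc i)
  refine ⟨τ, ?_, ?_⟩
  · show ∑ i ∈ Finset.range 0, g i = 0
    simp
  · intro j
    match j with
    | Int.ofNat n =>
      show ∑ i ∈ Finset.range (n + 1), g i - ∑ i ∈ Finset.range n, g i = g n
      rw [Finset.sum_range_succ]; ring
    | Int.negSucc 0 =>
      show ∑ i ∈ Finset.range 0, g i - -∑ i ∈ Finset.range (0 + 1), g (Int.negSucc i) = _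
      simp
    | Int.negSucc (n + 1) =>
      show -∑ i ∈ Finset.range (n + 1), g (Int.negSucc i)
        - -∑ i ∈ Finset.range (n + 1 + 1), g (Int.negSucc i) = _
      rw [Finset.sum_range_succ _ (n + 1)]; ring

theorem aux_orbit {M : Type*} [MetricSpace M] (φ : Flow ℝ M) (σ : ℤ → ℝ) (Z : ℤ → M)
    (h0 : σ 0 = 0) (hZ : ∀ j, Z (j + 1) = φ (σ (j + 1) - σ j) (Z j)) (j : ℤ) :
    φ (σ j) (Z 0) = Z j := by
  induction j using Int.induction_on with
  | zero => rw [h0, φ.map_zero_apply]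
  | succ n ih =>
    rw [hZ, ← ih, ← φ.map_add]; congr 1; ring
  | pred n ih =>
    have h := hZ (-(n : ℤ) - 1)
    rw [sub_add_cancel] at h
    rw [h] at ih
    have h2 := congrArg (φ (-(σ (-(n : ℤ)) - σ (-(n : ℤ) - 1)))) ih
    rw [← φ.map_add, ← φ.map_add, neg_add_cancel, φ.map_zero_apply] at h2
    rw [← h2]; congr 1; ring

theorem aux_uc {M : Type*} [MetricSpace M] [CompactSpace M] (φ : Flow ℝ M) (K e : ℝ)
    (he : 0 < e) : ∃ η, 0 < η ∧ ∀ u v x y, |u| ≤ K → |v| ≤ K → |u - v| < η → dist x y < η →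
      dist (φ u x) (φ v y) < e := by
  have hc : IsCompact (Set.Icc (-K) K ×ˢ (Set.univ : Set M)) := isCompact_Icc.prod isCompact_univ
  have hcont : Continuous (fun p : ℝ × M => φ p.1 p.2) :=
    φ.continuous continuous_fst continuous_snd
  have huc := hc.uniformContinuousOn_of_continuous hcont.continuousOn
  rw [Metric.uniformContinuousOn_iff] at huc
  obtain ⟨η, hη, H⟩ := huc e he
  refine ⟨η, hη, fun u v x y hu hv huv hxy => ?_⟩
  refine H (u, x) ⟨abs_le.mp hu, trivial⟩ (v, y) ⟨abs_le.mp hv, trivial⟩ ?_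
  rw [Prod.dist_eq]
  exact max_lt (by rwa [Real.dist_eq]) hxy

theorem aux_small {M : Type*} [MetricSpace M] [CompactSpace M] (φ : Flow ℝ M) (ρ κ : ℝ)
    (hnp : ∀ z s, |s| ≤ ρ → φ s z = z → s = 0) (hκ : 0 < κ) :
    ∃ η, 0 < η ∧ ∀ z s, |s| ≤ ρ → dist z (φ s z) < η → |s| < κ := by
  have hC : IsCompact ((Set.Icc (-ρ) ρ ∩ {s | κ ≤ |s|}) ×ˢ (Set.univ : Set M)) :=
    (isCompact_Icc.inter_right (isClosed_le continuous_const continuous_abs)).prod isCompact_univ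
  have hcont : Continuous (fun p : ℝ × M => dist p.2 (φ p.1 p.2)) :=
    continuous_snd.dist (φ.continuous continuous_fst continuous_snd)
  rcases Set.eq_empty_or_nonempty ((Set.Icc (-ρ) ρ ∩ {s | κ ≤ |s|}) ×ˢ (Set.univ : Set M))
    with he | hne
  · refine ⟨1, one_pos, fun z s hs _ => ?_⟩
    by_contra hk
    have : (s, z) ∈ ((Set.Icc (-ρ) ρ ∩ {s | κ ≤ |s|}) ×ˢ (Set.univ : Set M)) :=
      ⟨⟨abs_le.mp hs, not_lt.mp hk⟩, trivial⟩
    rw [he] at this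
    exact this
  · obtain ⟨p, hp, hmin⟩ := hC.exists_isMinOn hne hcont.continuousOn
    refine ⟨dist p.2 (φ p.1 p.2), ?_, fun z s hs hd => ?_⟩
    · rw [dist_pos]
      intro heq
      have h0 := hnp p.2 p.1 (abs_le.mpr hp.1.1) heq.symm
      have : κ ≤ |p.1| := hp.1.2
      rw [h0, abs_zero] at this
      linarith
    · by_contra hk
      have : (s, z) ∈ ((Set.Icc (-ρ) ρ ∩ {s | κ ≤ |s|}) ×ˢ (Set.univ : Set M)) :=
        ⟨⟨abs_le.mp hs, not_lt.mp hk⟩, trivial⟩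
      have := hmin this
      simp only [Set.mem_ofPred_eq] at this
      linarith

/-- Glue forward and backward companion sequences into two-sided ones. -/
theorem aux_glue {M : Type*} [MetricSpace M] (φ : Flow ℝ M) {k : ℕ}
    (S T : Fin k → Set M) (ρ η : ℝ) (x y : M)
    (hy : y ∈ stableSet φ S T ρ η x ∩ unstableSet φ S T ρ η x) :
    ∃ X Y : ℤ → M, X 0 = x ∧ Y 0 = y ∧ (∀ j, dist (X j) (Y j) < η) ∧
      ∀ j, ReturnStep φ S T ρ (X j) (Y j) (X (j + 1)) (Y (j + 1)) := by
  obtain ⟨⟨_, _, _, X, Y, hX, hY, hst, hd⟩, ⟨_, _, _, X', Y', hX', hY', hst', hd'⟩⟩ := hy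
  let Z : (ℕ → M) → (ℕ → M) → ℤ → M := fun f g j => match j with
    | Int.ofNat n => f n
    | Int.negSucc n => g (n + 1)
  refine ⟨Z X X', Z Y Y', hX, hY, ?_, ?_⟩
  · intro j
    match j with
    | Int.ofNat n => exact hd n
    | Int.negSucc n => exact hd' (n + 1)
  · intro j
    match j with
    | Int.ofNat n => exact hst n
    | Int.negSucc 0 =>
      have := hst' 0
      rw [hX', hY', ← hX, ← hY] at this
      exact this
    | Int.negSucc (n + 1) => exact hst' (n + 1)

/-- If a fixed-point-free flow on a compact metric space is N-expansive, then, given a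
δ-adequate pair `(𝒮,𝒯)` of cross-sections of time `ε` together with the associated
constants `θ`, `ρ`, `ε₀`, there is `η ∈ (0,ε₀)` such that `W^s_η(x) ∩ W^u_η(x)` has at
most `N` points for every `x ∈ ∪ᵢ Tᵢ`. -/
theorem stable_unstable_finite_of_nExpansive
    {M : Type*} [MetricSpace M] [CompactSpace M]
    (φ : Flow ℝ M) (hfix : ∀ p : M, ∃ t : ℝ, φ t p ≠ p)
    (N : ℕ) (hN : 0 < N)
    (ε δ : ℝ) (k : ℕ) (S T : Fin k → Set M)
    (hadeq : AdequatePair φ ε δ S T)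
    (θ : ℝ)
    (hθ : θ = sSup {d : ℝ | 0 < d ∧ ∀ i, ∀ x ∈ S i,
      ∀ t ∈ Set.Ioo (0 : ℝ) d, φ t x ∉ ⋃ j, S j})
    (ρ : ℝ) (hρ0 : 0 < ρ) (hρε : 5 * ρ < ε) (hρθ : 2 * ρ < θ)
    (ε₀ : ℝ) (hε₀0 : 0 < ε₀) (hε₀θ : ε₀ < θ / 2)
    (hε₀ : ∀ i j, ∀ x ∈ S i, ∀ y ∈ S i, dist x y < ε₀ →
      ∀ t : ℝ, |t| < 3 * δ → φ t x ∈ T j → φ t y ∈ flowIm φ (Set.Ioo (-ρ) ρ) (S j))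
    (hexp : NExpansive φ N) :
    ∃ η : ℝ, 0 < η ∧ η < ε₀ ∧ ∀ i, ∀ x ∈ T i,
      (stableSet φ S T ρ η x ∩ unstableSet φ S T ρ η x).Finite ∧
      (stableSet φ S T ρ η x ∩ unstableSet φ S T ρ η x).ncard ≤ N := by
  classical
  -- a good separation constant
  obtain ⟨d, ⟨hd0, hd⟩, hdρ⟩ : ∃ d ∈ {d : ℝ | 0 < d ∧ ∀ i, ∀ x ∈ S i,
      ∀ t ∈ Set.Ioo (0 : ℝ) d, φ t x ∉ ⋃ j, S j}, 2 * ρ < d := by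
    refine exists_lt_of_lt_csSup ?_ (hθ ▸ hρθ)
    by_contra hne
    rw [Set.not_nonempty_iff_eq_empty] at hne
    rw [hne, Real.sSup_empty] at hθ
    linarith
  have hTS : ∀ i, T i ⊆ S i := fun i z hz => (hadeq.T_sub i hz).2
  have hsep : ∀ z ∈ ⋃ i, S i, ∀ s, |s| < d → φ s z ∈ ⋃ i, S i → s = 0 := by
    intro z hz s hs hsz
    rcases lt_trichotomy s 0 with h | h | h
    · obtain ⟨i, hi⟩ := Set.mem_iUnion.mp hsz
      exfalso
      refine hd i _ hi (-s) ⟨by linarith, (neg_le_abs s).trans_lt hs⟩ ?_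
      rwa [← φ.map_add, neg_add_cancel, φ.map_zero_apply]
    · exact h
    · obtain ⟨i, hi⟩ := Set.mem_iUnion.mp hz
      exact absurd hsz (hd i _ hi s ⟨h, (le_abs_self s).trans_lt hs⟩)
  have hnp : ∀ z s, |s| ≤ ρ → φ s z = z → s = 0 := by
    intro z s hs hz
    have hzu : z ∈ ⋃ i, flowIm φ (Set.Icc 0 ε) (S i) := hadeq.coverS_fwd ▸ Set.mem_univ z
    obtain ⟨i, r, -, w, hw, rfl⟩ := Set.mem_iUnion.mp hzu
    have hw' : w ∈ ⋃ i, S i := Set.mem_iUnion.mpr ⟨i, hw⟩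
    refine hsep w hw' s (by linarith) ?_
    have : φ s w = w := by
      have h2 := congrArg (φ (-r)) hz
      simp only [← φ.map_add] at h2
      rwa [show -r + (s + r) = s by ring, neg_add_cancel, φ.map_zero_apply] at h2
    rwa [this]
  have hbound : ∀ z t, IsFirstReturn φ T z t → t ≤ ε + d := by
    rintro z t ⟨ht0, -, hmin⟩
    by_contra hlt
    have hzu : φ d z ∈ ⋃ i, flowIm φ (Set.Icc (-ε) 0) (T i) := hadeq.coverT_bwd ▸ Set.mem_univ _
    obtain ⟨i, r, hr, w, hw, hrw⟩ := Set.mem_iUnion.mp hzu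
    have hw2 : w = φ (-r + d) z := by
      rw [φ.map_add, ← hrw]
      simp only [← φ.map_add]
      rw [neg_add_cancel, φ.map_zero_apply]
    refine hmin (-r + d) (by linarith [hr.2]) (by linarith [hr.1]) ?_
    rw [← hw2]
    exact Set.mem_iUnion.mpr ⟨i, hw⟩
  obtain ⟨δ', hδ', hE⟩ := hexp (d / 2) (by linarith)
  have hεpos := hadeq.eps_pos
  obtain ⟨η1, hη1, H1⟩ := aux_uc φ (ε + d + ρ) (δ' / 4) (by linarith)
  obtain ⟨η2, hη2, H2⟩ := aux_small φ ρ η1 hnp hη1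
  obtain ⟨η3, hη3, H3⟩ := aux_uc φ (ε + d + ρ) (η2 / 2) (by linarith)
  obtain ⟨η, hη, hηa, hηb, hηc, hηd⟩ : ∃ η, 0 < η ∧ η ≤ η1 ∧ η ≤ η2 / 2 ∧ η ≤ η3 ∧ η < ε₀ :=
    ⟨min (min η1 (η2 / 2)) (min η3 (ε₀ / 2)), by positivity,
      (min_le_left _ _).trans (min_le_left _ _), (min_le_left _ _).trans (min_le_right _ _),
      (min_le_right _ _).trans (min_le_left _ _),
      ((min_le_right _ _).trans (min_le_right _ _)).trans_lt (by linarith)⟩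
  refine ⟨η, hη, hηd, fun i₀ x hx => ?_⟩
  -- every point of the intersection is shadowed by a reparametrization
  have hshadow : ∀ y ∈ stableSet φ S T ρ η x ∩ unstableSet φ S T ρ η x,
      ∃ h : ℝ ≃ₜ ℝ, h 0 = 0 ∧ ∀ t, dist (φ t x) (φ (h t) y) < δ' / 4 := by
    intro y hy
    obtain ⟨X, Y, hX0, hY0, hXY, hstep⟩ := aux_glue φ S T ρ η x y hy
    choose g hg hXg l hXl hYl s hs hYs using hstep
    have hXT : ∀ j, X j ∈ ⋃ i, S i := by
      intro j
      have := hTS _ (hXl (j - 1))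
      rw [sub_add_cancel] at this
      exact Set.mem_iUnion.mpr ⟨_, this⟩
    have hgd : ∀ j, d ≤ g j := by
      intro j
      by_contra hlt
      have h1 := (hg j).1
      have := hsep (X j) (hXT j) (g j) (by rw [abs_of_pos h1]; linarith)
        (by rw [← hXg]; exact hXT _)
      linarith
    obtain ⟨τ, hτ0, hτ⟩ := aux_sums g
    obtain ⟨σ, hσ0, hσ⟩ := aux_sums (fun j => s j + g j)
    have hXo := aux_orbit φ τ X hτ0 (fun j => by rw [hτ, ← hXg])
    have hYo := aux_orbit φ σ Y hσ0 (fun j => by rw [hσ, φ.map_add, ← hYs])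
    obtain ⟨h, h0, hh⟩ := aux_pl_homeo τ σ ρ hρ0 (fun j => by rw [hτ]; linarith [hgd j])
      (fun j => by rw [hσ]; linarith [hgd j, (abs_lt.mp (hs j)).1]) hτ0 hσ0
    refine ⟨h, h0, fun t => ?_⟩
    obtain ⟨j, r, hr0, hr1, ht, hht⟩ := hh t
    rw [hht, ht, hτ, hσ, φ.map_add, φ.map_add, ← hX0, ← hY0, hXo, hYo]
    have hgb := hbound _ _ (hg j)
    have hgj := hgd j
    have hsj := abs_lt.mp (hs j)
    have hsmall : |s j| < η1 := by
      refine H2 (φ (g j) (Y j)) (s j) (hs j).le ?_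
      rw [← hYs]
      have e1 := H3 (g j) (g j) (Y j) (X j) (by rw [abs_of_pos] <;> linarith)
        (by rw [abs_of_pos] <;> linarith) (by simpa using hη3)
        (by rw [dist_comm]; exact (hXY j).trans_le hηc)
      rw [← hXg] at e1
      have e2 := hXY (j + 1)
      have e3 := dist_triangle (φ (g j) (Y j)) (X (j + 1)) (Y (j + 1))
      linarith
    refine H1 _ _ _ _ ?_ ?_ ?_ ((hXY j).trans_le hηa)
    · rw [abs_of_nonneg (by nlinarith)]; nlinarith
    · rw [abs_of_nonneg (by nlinarith)]; nlinarith
    · rw [show r * g j - r * (s j + g j) = -(r * s j) by ring, abs_neg, abs_mul, abs_of_nonneg hr0]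
      nlinarith [abs_nonneg (s j)]
  have hWS : ∀ y ∈ stableSet φ S T ρ η x ∩ unstableSet φ S T ρ η x, y ∈ ⋃ i, S i := by
    rintro y ⟨⟨i, _, hy, _⟩, _⟩
    exact Set.mem_iUnion.mpr ⟨i, hy⟩
  generalize stableSet φ S T ρ η x ∩ unstableSet φ S T ρ η x = W at *
  rw [← Set.encard_le_coe_iff_finite_ncard_le]
  by_contra hlt
  have hle : ((N + 1 : ℕ) : ℕ∞) ≤ W.encard := by
    push_cast
    exact Order.add_one_le_of_lt (not_le.mp hlt)
  obtain ⟨F, hFW, hF⟩ := Set.exists_subset_encard_eq hle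
  have hFfin : F.Finite := Set.finite_of_encard_eq_coe hF
  have hex : ∀ y, ∃ h : ℝ ≃ₜ ℝ, y ∈ F → (h 0 = 0 ∧ ∀ t, dist (φ t x) (φ (h t) y) < δ' / 4) := by
    intro y
    by_cases hy : y ∈ F
    · obtain ⟨h, hh⟩ := hshadow y (hFW hy)
      exact ⟨h, fun _ => hh⟩
    · exact ⟨Homeomorph.refl ℝ, fun h => absurd h hy⟩
  choose β hβ using hex
  let α : M → ℝ ≃ₜ ℝ := fun y => if y = x then Homeomorph.refl ℝ else β y
  have hαx : α x = Homeomorph.refl ℝ := if_pos rfl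
  have hαn : ∀ y, y ≠ x → α y = β y := fun y hy => if_neg hy
  have hA : ∀ y ∈ insert x F, α y 0 = 0 ∧ ∀ t, dist (φ t x) (φ (α y t) y) < δ' / 4 := by
    intro y hy
    by_cases hyx : y = x
    · subst hyx
      rw [hαx]
      refine ⟨rfl, fun t => ?_⟩
      simp only [Homeomorph.refl_apply, id, dist_self]
      linarith
    · rw [hαn y hyx]
      exact hβ y (hy.resolve_left hyx)
  obtain ⟨B, -, hBfin, hBcard, hB⟩ := hE (insert x F) α x
    ⟨Set.mem_insert _ _, fun t => by rw [hαx]; rfl, fun y hy => (hA y hy).1,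
      fun t => (hFfin.insert x).continuousOn _⟩
    (fun t => by
      refine lt_of_le_of_lt (Metric.diam_le_of_forall_dist_le (C := δ' / 2) (by linarith) ?_)
        (by linarith)
      rintro _ ⟨y, hy, rfl⟩ _ ⟨z, hz, rfl⟩
      have e1 := (hA y hy).2 t
      have e2 := (hA z hz).2 t
      have e3 := dist_triangle_left (φ (α y t) y) (φ (α z t) z) (φ t x)
      simp only
      linarith)
  have hB' : ∀ a, ∃ b, a ∈ F → b ∈ B ∧ ∃ s : ℝ, |s| < d / 2 ∧ φ s b = a := by
    intro a
    by_cases ha : a ∈ F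
    · obtain ⟨b, hb, h⟩ := hB a (Set.mem_insert_of_mem _ ha)
      exact ⟨b, fun _ => ⟨hb, h⟩⟩
    · exact ⟨a, fun h => absurd h ha⟩
  choose f hf using hB'
  have hFcard : F.ncard = N + 1 := by
    rw [Set.ncard, hF]; rfl
  obtain ⟨a, ha, b, hb, hab, hfab⟩ := Set.exists_ne_map_eq_of_ncard_lt_of_maps_to
    (by omega : B.ncard < F.ncard) (fun a ha => (hf a ha).1) hBfin
  obtain ⟨-, s, hs, hsa⟩ := hf a ha
  obtain ⟨-, s', hs', hsb⟩ := hf b hb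
  have hba : φ (s' - s) a = b := by
    rw [← hsa, ← φ.map_add, sub_add_cancel, hfab, hsb]
  have h0 := hsep a (hWS a (hFW ha)) (s' - s)
    (by have := abs_sub s' s; linarith) (by rw [hba]; exact hWS b (hFW hb))
  rw [h0, φ.map_zero_apply] at hba
  exact hab hba
end
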